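/- Let 1 ≤ p < 2 and let A ∈ ℝ^{m×n} satisfy: for every k-sparse x ∈ ℝⁿ, ‖x‖_p ≤ ‖Ax‖_p ≤ D·‖x‖_p (i.e., A is (k,D)-ℓ_p-RIP with normalization K = 1), where 1 ≤ k ≤ n. Then for every subset S ⊆ {1,…,n} with |S| ≤ k, it holds that Σ_{i=1}^m ‖A_{i,S}‖₂^p ≥ |S|, where A_{i,S} denotes the i-th row of A restricted to the coordinates in S. -/

import Mathlib

open Finset

/-- The ℓ_p norm of a vector `x`, `‖x‖_p = (∑ i, |x i|^p)^(1/p)`. -/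
noncomputable def pNorm (p : ℝ) {ι : Type*} [Fintype ι] (x : ι → ℝ) : ℝ :=
  (∑ i, |x i| ^ p) ^ (1 / p)

/-- The (ℓ_q, ℓ_p)-distortion of a vector `x ∈ ℝⁿ`:
`Δ_{q,p}(x) = ‖x‖_p · n^(1/q - 1/p) / ‖x‖_q`. -/
noncomputable def distortion (q p : ℝ) {ι : Type*} [Fintype ι] (x : ι → ℝ) : ℝ :=
  pNorm p x * (Fintype.card ι : ℝ) ^ (1 / q - 1 / p) / pNorm q x

/-- A vector is `k`-sparse if it has at most `k` nonzero entries. -/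
def IsSparse (k : ℝ) {ι : Type*} [Fintype ι] (x : ι → ℝ) : Prop :=
  ((Finset.univ.filter (fun i => x i ≠ 0)).card : ℝ) ≤ k

/-- A matrix `A` is `(k, D)`-ℓ_p-RIP if there is `K > 0` with
`K‖x‖_p ≤ ‖Ax‖_p ≤ D·K‖x‖_p` for every `k`-sparse `x`. -/
def IsRIP (p : ℝ) {ι κ : Type*} [Fintype ι] [Fintype κ] (A : Matrix ι κ ℝ) (k D : ℝ) : Prop :=
  ∃ K > 0, ∀ x : κ → ℝ, IsSparse k x →
    K * pNorm p x ≤ pNorm p (A.mulVec x) ∧ pNorm p (A.mulVec x) ≤ D * K * pNorm p x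

/-- A matrix `A ∈ ℝ^{m×n}` is `(k, D)`-ℓ₂-ARIP if there is `K > 0` with
`K‖x‖₂ ≤ ‖Ax‖₂ ≤ D·K‖x‖₂` for every `x` with `Δ_{1,2}(x) ≥ (n/k)^(1/2)`. -/
def IsARIP {ι κ : Type*} [Fintype ι] [Fintype κ] (A : Matrix ι κ ℝ) (k D : ℝ) : Prop :=
  ∃ K > 0, ∀ x : κ → ℝ, ((Fintype.card κ : ℝ) / k) ^ ((1 : ℝ) / 2) ≤ distortion 1 2 x →
    K * pNorm 2 x ≤ pNorm 2 (A.mulVec x) ∧ pNorm 2 (A.mulVec x) ≤ D * K * pNorm 2 x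

/-- The Frobenius norm of a matrix. -/
noncomputable def frobNorm {ι κ : Type*} [Fintype ι] [Fintype κ] (A : Matrix ι κ ℝ) : ℝ :=
  Real.sqrt (∑ i, ∑ j, (A i j) ^ 2)

/-- Raising the ℓ_p norm to the power `p` removes the outer root. -/
theorem pNorm_rpow {p : ℝ} (hp : p ≠ 0) {ι : Type*} [Fintype ι] (x : ι → ℝ) :
    pNorm p x ^ p = ∑ i, |x i| ^ p := by
  rw [pNorm, ← Real.rpow_mul (Finset.sum_nonneg fun i _ => by positivity),
    one_div_mul_cancel hp, Real.rpow_one]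

/-- The ℓ_p norm is nonnegative. -/
theorem pNorm_nonneg (p : ℝ) {ι : Type*} [Fintype ι] (x : ι → ℝ) : 0 ≤ pNorm p x :=
  Real.rpow_nonneg (Finset.sum_nonneg fun i _ => by positivity) _

/-- Distinct coordinates of a uniformly random sign vector are uncorrelated. -/
theorem sum_sign_mul_sign_eq_zero {κ : Type*} [Fintype κ] [DecidableEq κ] {j l : κ}
    (h : j ≠ l) : ∑ σ : κ → ℤˣ, (((σ j : ℤˣ) : ℤ) : ℝ) * (((σ l : ℤˣ) : ℤ) : ℝ) = 0 := by
  have key := Equiv.sum_comp (Equiv.mulLeft (Pi.mulSingle j (-1) : κ → ℤˣ))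
    (fun σ : κ → ℤˣ => (((σ j : ℤˣ) : ℤ) : ℝ) * (((σ l : ℤˣ) : ℤ) : ℝ))
  simp only [Equiv.coe_mulLeft, Pi.mul_apply, Pi.mulSingle_eq_same,
    Pi.mulSingle_eq_of_ne h.symm, one_mul, neg_mul, Units.val_neg, Int.cast_neg,
    Finset.sum_neg_distrib] at key
  linarith

/-- The square of a sign is one. -/
theorem cast_sign_mul_self (u : ℤˣ) : ((u : ℤ) : ℝ) * ((u : ℤ) : ℝ) = 1 := by
  rcases Int.units_eq_one_or u with h | h <;> simp [h]

/-- The second moment of a Rademacher sum. -/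
theorem sum_sq_sign_combination {κ : Type*} [Fintype κ] [DecidableEq κ] (a : κ → ℝ) :
    ∑ σ : κ → ℤˣ, (∑ j, a j * ((σ j : ℤˣ) : ℤ)) ^ 2
      = Fintype.card (κ → ℤˣ) * ∑ j, a j ^ 2 := by
  calc ∑ σ : κ → ℤˣ, (∑ j, a j * ((σ j : ℤˣ) : ℤ)) ^ 2
      = ∑ σ : κ → ℤˣ, ∑ j, ∑ l, a j * a l * ((((σ j : ℤˣ) : ℤ) : ℝ) * ((σ l : ℤˣ) : ℤ)) := by
        refine Finset.sum_congr rfl fun σ _ => ?_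
        rw [sq, Finset.sum_mul_sum]
        exact Finset.sum_congr rfl fun j _ => Finset.sum_congr rfl fun l _ => by ring
    _ = ∑ j, ∑ l, a j * a l * ∑ σ : κ → ℤˣ, (((σ j : ℤˣ) : ℤ) : ℝ) * ((σ l : ℤˣ) : ℤ) := by
        rw [Finset.sum_comm]
        refine Finset.sum_congr rfl fun j _ => ?_
        rw [Finset.sum_comm]
        exact Finset.sum_congr rfl fun l _ => (Finset.mul_sum _ _ _).symm
    _ = ∑ j, (Fintype.card (κ → ℤˣ) : ℝ) * a j ^ 2 := by
        refine Finset.sum_congr rfl fun j _ => ?_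
        rw [Finset.sum_eq_single j
          (fun l _ hl => by rw [sum_sign_mul_sign_eq_zero hl.symm, mul_zero]) (by simp)]
        simp only [cast_sign_mul_self, Finset.sum_const, Finset.card_univ, nsmul_eq_mul]
        ring
    _ = Fintype.card (κ → ℤˣ) * ∑ j, a j ^ 2 := (Finset.mul_sum _ _ _).symm

/-- The easy half of Khintchine's inequality: for `0 < p ≤ 2` the `p`-th moment of a Rademacher
sum is at most the `p`-th power of the ℓ₂ norm of its coefficients. -/
theorem sum_abs_sign_combination_rpow_le {p : ℝ} (hp : 0 < p) (hp2 : p ≤ 2) {κ : Type*}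
    [Fintype κ] [DecidableEq κ] (a : κ → ℝ) :
    ∑ σ : κ → ℤˣ, |∑ j, a j * ((σ j : ℤˣ) : ℤ)| ^ p
      ≤ Fintype.card (κ → ℤˣ) * (∑ j, a j ^ 2) ^ (p / 2) := by
  set N : ℝ := ((Fintype.card (κ → ℤˣ) : ℕ) : ℝ) with hN
  have hNpos : 0 < N := by rw [hN]; exact_mod_cast Fintype.card_pos
  have key := Real.arith_mean_le_rpow_mean Finset.univ (fun _ : κ → ℤˣ => N⁻¹)
    (fun σ => |∑ j, a j * ((σ j : ℤˣ) : ℤ)| ^ p) (fun _ _ => by positivity)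
    (by rw [Finset.sum_const, Finset.card_univ, nsmul_eq_mul, ← hN, mul_inv_cancel₀ hNpos.ne'])
    (fun _ _ => by positivity) (p := 2 / p) ((one_le_div hp).2 hp2)
  have hsq (σ : κ → ℤˣ) : (|∑ j, a j * ((σ j : ℤˣ) : ℤ)| ^ p) ^ (2 / p)
      = (∑ j, a j * ((σ j : ℤˣ) : ℤ)) ^ 2 := by
    rw [← Real.rpow_mul (abs_nonneg _), mul_div_cancel₀ _ hp.ne', Real.rpow_two, sq_abs]
  simp only [hsq] at key
  rw [← Finset.mul_sum, ← Finset.mul_sum, sum_sq_sign_combination, ← hN,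
    inv_mul_cancel_left₀ hNpos.ne', one_div_div, inv_mul_le_iff₀ hNpos] at key
  exact key

/-- Let `1 ≤ p < 2` and suppose `A ∈ ℝ^{m×n}` satisfies `‖x‖_p ≤ ‖Ax‖_p ≤ D‖x‖_p` for every
`k`-sparse `x`, where `1 ≤ k ≤ n`. Then for every `S ⊆ {1,…,n}` with `|S| ≤ k`,
`∑ᵢ ‖A_{i,S}‖₂^p ≥ |S|`. -/
theorem rip_restricted_rows_lower {m n : ℕ} (p D : ℝ) (hp : 1 ≤ p) (hp2 : p < 2)
    (k : ℕ) (hk : 1 ≤ k) (hkn : k ≤ n) (A : Matrix (Fin m) (Fin n) ℝ)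
    (hA : ∀ x : Fin n → ℝ, (Finset.univ.filter (fun j => x j ≠ 0)).card ≤ k →
      pNorm p x ≤ pNorm p (A.mulVec x) ∧ pNorm p (A.mulVec x) ≤ D * pNorm p x)
    (S : Finset (Fin n)) (hS : S.card ≤ k) :
    ∑ i : Fin m, pNorm 2 (fun j : {j : Fin n // j ∈ S} => A i j) ^ p ≥ (S.card : ℝ) := by
  classical
  have hp0 : 0 < p := by linarith
  let x (σ : Fin n → ℤˣ) (j : Fin n) : ℝ := if j ∈ S then ((σ j : ℤˣ) : ℤ) else 0
  let a (i : Fin m) (j : Fin n) : ℝ := if j ∈ S then A i j else 0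
  have hlow (σ : Fin n → ℤˣ) :
      (S.card : ℝ) ≤ ∑ i, |∑ j, a i j * ((σ j : ℤˣ) : ℤ)| ^ p := by
    have hsparse : (Finset.univ.filter (fun j => x σ j ≠ 0)).card ≤ k := by
      refine (Finset.card_le_card fun j hj => ?_).trans hS
      by_contra hjS
      simp [x, hjS] at hj
    have h := Real.rpow_le_rpow (pNorm_nonneg p _) (hA (x σ) hsparse).1 hp0.le
    rw [pNorm_rpow hp0.ne', pNorm_rpow hp0.ne'] at h
    have hx : ∑ j, |x σ j| ^ p = S.card := by
      have hterm (j : Fin n) : |x σ j| ^ p = if j ∈ S then 1 else 0 := by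
        by_cases hj : j ∈ S
        · rcases Int.units_eq_one_or (σ j) with hσ | hσ <;> simp [x, hj, hσ]
        · simp [x, hj, Real.zero_rpow hp0.ne']
      simp [hterm]
    have hmul (i : Fin m) : A.mulVec (x σ) i = ∑ j, a i j * ((σ j : ℤˣ) : ℤ) := by
      simp [Matrix.mulVec, dotProduct, x, a]
    simpa only [hx, hmul] using h
  have hrow (i : Fin m) : pNorm 2 (fun j : {j : Fin n // j ∈ S} => A i j) ^ p
      = (∑ j, a i j ^ 2) ^ (p / 2) := by
    have hsum : ∑ j : {j : Fin n // j ∈ S}, |A i j| ^ (2 : ℝ) = ∑ j, a i j ^ 2 := by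
      simp only [Real.rpow_two, sq_abs, a, ite_pow, ne_eq, OfNat.ofNat_ne_zero,
        not_false_eq_true, zero_pow, Finset.sum_ite_mem, Finset.univ_inter]
      exact Finset.sum_coe_sort S fun j => A i j ^ 2
    rw [pNorm, hsum, ← Real.rpow_mul (by positivity), one_div_mul_eq_div]
  have hcard : (0 : ℝ) < Fintype.card (Fin n → ℤˣ) := by exact_mod_cast Fintype.card_pos
  refine le_of_mul_le_mul_left ?_ hcard
  calc (Fintype.card (Fin n → ℤˣ) : ℝ) * S.card
      = ∑ _σ : Fin n → ℤˣ, (S.card : ℝ) := by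
        rw [Finset.sum_const, Finset.card_univ, nsmul_eq_mul]
    _ ≤ ∑ σ : Fin n → ℤˣ, ∑ i, |∑ j, a i j * ((σ j : ℤˣ) : ℤ)| ^ p :=
        Finset.sum_le_sum fun σ _ => hlow σ
    _ = ∑ i, ∑ σ : Fin n → ℤˣ, |∑ j, a i j * ((σ j : ℤˣ) : ℤ)| ^ p := Finset.sum_comm
    _ ≤ ∑ i, Fintype.card (Fin n → ℤˣ) * (∑ j, a i j ^ 2) ^ (p / 2) :=
        Finset.sum_le_sum fun i _ => sum_abs_sign_combination_rpow_le hp0 hp2.le (a i)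
    _ = Fintype.card (Fin n → ℤˣ)
          * ∑ i, pNorm 2 (fun j : {j : Fin n // j ∈ S} => A i j) ^ p := by
        simp only [hrow, Finset.mul_sum]
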